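/- arXiv:1607.04725 — 2 statements merged into one kernel-verified Lean document; each statement's English description precedes it below -/
import Mathlib

section
/- The number of r-dimensional subspaces U of F_q^k whose set of contained standard unit vectors {i : e_i \in U} has cardinality exactly x equals \binom{k}{x} \sum_{j=0}^{k-x} (-1)^j \binom{k-x}{j} [k-x-j choose r-x-j]_q; equivalently, if U is a uniformly random r-dimensional subspace of F_q^k, the probability that U contains exactly x of the k standard unit vectors is (\binom{k}{x} / [k choose r]_q) \sum_{j=0}^{k-x} (-1)^j \binom{k-x}{j} [k-x-j choose r-x-j]_q. -/
/-- The Gaussian binomial coefficient `[m, d]_q`. -/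
def gaussBinom (q : ℕ) : ℕ → ℕ → ℕ
  | _, 0 => 1
  | 0, _ + 1 => 0
  | m + 1, d + 1 => gaussBinom q m d + q ^ (d + 1) * gaussBinom q m (d + 1)

/-- Gaussian binomial with integer lower index, vanishing for negative index. -/
def gaussBinomZ (q m : ℕ) (d : ℤ) : ℕ :=
  if 0 ≤ d then gaussBinom q m d.toNat else 0

/-- product formula for the Gaussian binomial -/
lemma gaussBinom_mul_prod (q : ℕ) (n r : ℕ) :
    (gaussBinom q n r : ℤ) * ∏ i ∈ Finset.range r, ((q : ℤ) ^ r - (q : ℤ) ^ i)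
      = ∏ i ∈ Finset.range r, ((q : ℤ) ^ n - (q : ℤ) ^ i) := by
  have key : ∀ m d : ℕ, ∏ i ∈ Finset.range (d + 1), ((q : ℤ) ^ (m + 1) - (q : ℤ) ^ i)
      = ((q : ℤ) ^ (m + 1) - 1) * (q : ℤ) ^ d *
        ∏ i ∈ Finset.range d, ((q : ℤ) ^ m - (q : ℤ) ^ i) := by
    intro m d
    rw [Finset.prod_range_succ']
    have : ∏ i ∈ Finset.range d, ((q : ℤ) ^ (m + 1) - (q : ℤ) ^ (i + 1))
        = (q : ℤ) ^ d * ∏ i ∈ Finset.range d, ((q : ℤ) ^ m - (q : ℤ) ^ i) := by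
      rw [← Finset.card_range d, ← Finset.prod_const, Finset.card_range,
        ← Finset.prod_mul_distrib]
      refine Finset.prod_congr rfl fun i _ => ?_
      ring
    rw [this]
    ring
  induction n generalizing r with
  | zero =>
    cases r with
    | zero => simp [gaussBinom]
    | succ d =>
      rw [Finset.prod_range_succ' (fun i => (q : ℤ) ^ 0 - (q : ℤ) ^ i)]
      simp [gaussBinom]
  | succ m ih =>
    cases r with
    | zero => simp [gaussBinom]
    | succ d =>
      have h1 := ih d
      have h2 := ih (d + 1)
      rw [Finset.prod_range_succ (fun i => (q : ℤ) ^ m - (q : ℤ) ^ i)] at h2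
      rw [key m d]
      simp only [gaussBinom]
      push_cast
      rw [add_mul, mul_assoc, h2, key d d]
      linear_combination ((q : ℤ) ^ (d + 1) - 1) * (q : ℤ) ^ d * h1

lemma card_subspaces_finrank (F : Type*) [Field F] [Fintype F] (V : Type*) [AddCommGroup V]
    [Module F V] [Finite V] (r : ℕ) (hr : r ≤ Module.finrank F V) :
    Nat.card {U : Submodule F V // Module.finrank F U = r}
      = gaussBinom (Fintype.card F) (Module.finrank F V) r := by
  classical
  set q := Fintype.card F with hq
  set n := Module.finrank F V with hn
  have q1 : 1 < q := Fintype.one_lt_card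
  let e : {s : Fin r → V // LinearIndependent F s} ≃
      Σ U : {U : Submodule F V // Module.finrank F U = r},
        {s : Fin r → U.1 // LinearIndependent F s} :=
    { toFun := fun s => ⟨⟨Submodule.span F (Set.range s.1), by
          rw [finrank_span_eq_card s.2, Fintype.card_fin]⟩,
          ⟨fun i => ⟨s.1 i, Submodule.subset_span ⟨i, rfl⟩⟩,
            LinearIndependent.of_comp (Submodule.subtype _) s.2⟩⟩
      invFun := fun t => ⟨fun i => (t.2.1 i : V),
        t.2.2.map' (Submodule.subtype _) (Submodule.ker_subtype _)⟩
      left_inv := fun s => rfl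
      right_inv := by
        rintro ⟨⟨U, hU⟩, ⟨s, hs⟩⟩
        have h : Submodule.span F (Set.range fun i => (s i : V)) = U := by
          apply Submodule.eq_of_le_of_finrank_eq
          · rw [Submodule.span_le]
            rintro _ ⟨i, rfl⟩
            exact (s i).2
          · have := hs.map' (Submodule.subtype U) (Submodule.ker_subtype _)
            have h2 := finrank_span_eq_card this
            rw [Fintype.card_fin] at h2
            rw [hU]
            exact h2
        have aux : ∀ (W : Submodule F V) (_ : W = U) (hW : Module.finrank F W = r)
            (hm : ∀ i, (s i : V) ∈ W)
            (hl : LinearIndependent F (fun i => (⟨(s i : V), hm i⟩ : W))),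
            (⟨⟨W, hW⟩, ⟨fun i => ⟨(s i : V), hm i⟩, hl⟩⟩ :
              Σ U : {U : Submodule F V // Module.finrank F U = r},
                {s : Fin r → U.1 // LinearIndependent F s}) = ⟨⟨U, hU⟩, ⟨s, hs⟩⟩ := by
          intro W hWU hW hm hl
          subst hWU
          rfl
        exact aux _ h _ _ _ }
  have h := Nat.card_congr e
  have : Finite (Submodule F V) := inferInstance
  have := Fintype.ofFinite {U : Submodule F V // Module.finrank F U = r}
  rw [Nat.card_sigma, card_linearIndependent hr] at h
  have h3 : ∀ U : {U : Submodule F V // Module.finrank F U = r},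
      Nat.card {s : Fin r → U.1 // LinearIndependent F s} = ∏ i : Fin r, (q ^ r - q ^ i.val) := by
    intro U
    rw [card_linearIndependent (by rw [U.2]), U.2]
  rw [Finset.sum_congr rfl (fun U _ => h3 U), Finset.sum_const, Finset.card_univ,
    ← Nat.card_eq_fintype_card (α := {U : Submodule F V // Module.finrank F U = r}), smul_eq_mul] at h
  have cast : ∀ m, r ≤ m → ((∏ i : Fin r, (q ^ m - q ^ i.val) : ℕ) : ℤ)
      = ∏ i ∈ Finset.range r, ((q : ℤ) ^ m - (q : ℤ) ^ i) := by
    intro m hm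
    rw [Finset.prod_range, Nat.cast_prod]
    refine Finset.prod_congr rfl fun i _ => ?_
    rw [Nat.cast_sub (Nat.pow_le_pow_right q1.le (by omega))]
    push_cast
    rfl
  have h4 := gaussBinom_mul_prod q n r
  rw [← cast r le_rfl, ← cast n hr] at h4
  have h5 : gaussBinom q n r * (∏ i : Fin r, (q ^ r - q ^ i.val))
    = ∏ i : Fin r, (q ^ n - q ^ i.val) := by exact_mod_cast h4
  have pos : 0 < ∏ i : Fin r, (q ^ r - q ^ i.val) :=
    Finset.prod_pos fun i _ => Nat.sub_pos_of_lt (Nat.pow_lt_pow_right q1 i.2)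
  exact Nat.eq_of_mul_eq_mul_right pos (by rw [h5]; exact h.symm)

lemma card_subspaces_ge (F : Type*) [Field F] [Fintype F] (V : Type*) [AddCommGroup V]
    [Module F V] [Finite V] (r s : ℕ) (hr : r ≤ Module.finrank F V) (W : Submodule F V)
    (hW : Module.finrank F W = s) :
    Nat.card {U : Submodule F V // Module.finrank F U = r ∧ W ≤ U}
      = gaussBinomZ (Fintype.card F) (Module.finrank F V - s) ((r : ℤ) - s) := by
  classical
  have : Finite (V ⧸ W) := Finite.of_surjective _ (Submodule.mkQ_surjective W)
  by_cases hs : s ≤ r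
  · have e0 : ((r : ℤ) - s) = ((r - s : ℕ) : ℤ) := by omega
    have hq := Submodule.finrank_quotient_add_finrank W
    rw [gaussBinomZ, e0, if_pos (by positivity), Int.toNat_natCast,
      show Module.finrank F V - s = Module.finrank F (V ⧸ W) by omega,
      ← card_subspaces_finrank F (V ⧸ W) (r - s) (by omega)]
    have hfin : ∀ U : Submodule F V, W ≤ U →
        Module.finrank F (U.map W.mkQ) + s = Module.finrank F U := by
      intro U hU
      have h1 := (Submodule.quotientQuotientEquivQuotient W U hU).finrank_eq
      have h2 := Submodule.finrank_quotient_add_finrank U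
      have h3 := Submodule.finrank_quotient_add_finrank (U.map W.mkQ)
      omega
    refine Nat.card_congr
      { toFun := fun U => ⟨U.1.map W.mkQ, by have := hfin U.1 U.2.2; have := U.2.1; omega⟩
        invFun := fun T => ⟨T.1.comap W.mkQ, ?_, Submodule.le_comap_mkQ _ _⟩
        left_inv := ?_
        right_inv := ?_ }
    · have := hfin (T.1.comap W.mkQ) (Submodule.le_comap_mkQ _ _)
      rw [Submodule.map_comap_eq_of_surjective (Submodule.mkQ_surjective W)] at this
      have := T.2
      omega
    · intro U
      apply Subtype.ext
      simp [Submodule.comap_map_mkQ, U.2.2]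
    · intro T
      apply Subtype.ext
      exact Submodule.map_comap_eq_of_surjective (Submodule.mkQ_surjective W) _
  · rw [gaussBinomZ, if_neg (by omega)]
    have : IsEmpty {U : Submodule F V // Module.finrank F U = r ∧ W ≤ U} := by
      refine ⟨fun U => ?_⟩
      have := Submodule.finrank_mono U.2.2
      have := U.2.1
      omega
    simp

lemma indicator_identity (k x a : ℕ) (ha : a ≤ k) :
    (if a = x then (1 : ℤ) else 0) = ∑ j ∈ Finset.range (k - x + 1),
      (-1 : ℤ) ^ j * ((x + j).choose x : ℤ) * (a.choose (x + j) : ℤ) := by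
  have h : ∀ j, (-1 : ℤ) ^ j * ((x + j).choose x : ℤ) * (a.choose (x + j) : ℤ)
      = (a.choose x : ℤ) * ((-1 : ℤ) ^ j * ((a - x).choose j : ℤ)) := by
    intro j
    have := Nat.choose_mul (n := a) (k := x + j) (s := x) (by omega)
    rw [Nat.add_sub_cancel_left] at this
    have h' : (a.choose (x + j) : ℤ) * ((x + j).choose x : ℤ)
      = (a.choose x : ℤ) * ((a - x).choose j : ℤ) := by exact_mod_cast this
    linear_combination (-1 : ℤ) ^ j * h'
  rw [Finset.sum_congr rfl (fun j _ => h j), ← Finset.mul_sum]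
  by_cases hax : a < x
  · rw [Nat.choose_eq_zero_of_lt hax, if_neg (by omega)]
    simp
  · have hsub : Finset.range (a - x + 1) ⊆ Finset.range (k - x + 1) :=
      Finset.range_subset_range.2 (by omega)
    rw [← Finset.sum_subset hsub, Int.alternating_sum_range_choose]
    · by_cases hx : a = x
      · subst hx; simp
      · rw [if_neg hx, if_neg (by omega), mul_zero]
    · intro j _ hj
      rw [Nat.choose_eq_zero_of_lt (by simpa using hj)]
      simp

lemma main_count {q k x r : ℕ} (F : Type*) [Field F] [Fintype F]
    (hF : Fintype.card F = q) (hrk : r ≤ k) :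
    (({U : Submodule F (Fin k → F) |
        Module.finrank F U = r ∧ {i | Pi.single i (1 : F) ∈ U}.ncard = x}.ncard : ℤ)
      = (k.choose x : ℤ) *
          ∑ j ∈ Finset.range (k - x + 1),
            (-1 : ℤ) ^ j * ((k - x).choose j : ℤ) *
              (gaussBinomZ q (k - x - j) ((r : ℤ) - x - j) : ℤ)) := by
  classical
  have : Finite (Submodule F (Fin k → F)) := inferInstance
  have := Fintype.ofFinite (Submodule F (Fin k → F))
  let A : Submodule F (Fin k → F) → Finset (Fin k) := fun U =>
    Finset.univ.filter fun i => Pi.single i (1 : F) ∈ U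
  let R : Finset (Submodule F (Fin k → F)) :=
    Finset.univ.filter fun U => Module.finrank F U = r
  have hset : {U : Submodule F (Fin k → F) |
        Module.finrank F U = r ∧ {i | Pi.single i (1 : F) ∈ U}.ncard = x}
      = ((R.filter fun U => (A U).card = x : Finset _) : Set (Submodule F (Fin k → F))) := by
    ext U
    have : {i | Pi.single i (1 : F) ∈ U} = ((A U : Finset (Fin k)) : Set (Fin k)) := by
      ext i; simp [A]
    rw [Set.mem_ofPred_eq, this, Set.ncard_coe_finset]
    simp [R]
  -- number of subspaces containing a prescribed set of unit vectors
  have hS : ∀ S : Finset (Fin k), (R.filter fun U => S ⊆ A U).card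
      = gaussBinomZ q (k - S.card) ((r : ℤ) - S.card) := by
    intro S
    let b : S → (Fin k → F) := fun i => Pi.single i.1 (1 : F)
    have hb : LinearIndependent F b := by
      have h := (Pi.basisFun F (Fin k)).linearIndependent
      have h' := h.comp (fun i : S => i.1) Subtype.val_injective
      convert h' using 1
      ext i
      simp [b]
    have hf := finrank_span_eq_card hb
    rw [Fintype.card_coe] at hf
    have := card_subspaces_ge F (Fin k → F) r S.card (by simpa using hrk) _ hf
    rw [Module.finrank_fin_fun, hF] at this
    rw [← this, Nat.card_eq_fintype_card, Fintype.card_subtype, Finset.filter_filter]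
    congr 1
    ext U
    simp only [Finset.mem_filter, Finset.mem_univ, true_and, Submodule.span_le,
      Set.range_subset_iff, A, Finset.subset_iff, SetLike.mem_coe, b, Subtype.forall]
  have hcount : ∀ s : ℕ, ∑ U ∈ R, ((A U).card.choose s)
      = k.choose s * gaussBinomZ q (k - s) ((r : ℤ) - s) := by
    intro s
    have h := Finset.sum_card_bipartiteAbove_eq_sum_card_bipartiteBelow
      (fun (U : Submodule F (Fin k → F)) (S : Finset (Fin k)) => S ⊆ A U) (s := R)
      (t := Finset.powersetCard s Finset.univ)
    have h1 : ∀ U ∈ R, (Finset.bipartiteAbove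
        (fun (U : Submodule F (Fin k → F)) (S : Finset (Fin k)) => S ⊆ A U)
        (Finset.powersetCard s Finset.univ) U).card = (A U).card.choose s := by
      intro U _
      rw [← Finset.card_powersetCard]
      congr 1
      ext S
      simp [Finset.bipartiteAbove, Finset.mem_powersetCard, and_comm]
    have h2 : ∀ S ∈ Finset.powersetCard s (Finset.univ : Finset (Fin k)),
        (Finset.bipartiteBelow
        (fun (U : Submodule F (Fin k → F)) (S : Finset (Fin k)) => S ⊆ A U) R S).card
        = gaussBinomZ q (k - s) ((r : ℤ) - s) := by
      intro S hs
      rw [← (Finset.mem_powersetCard.1 hs).2, ← hS S]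
      rfl
    rw [Finset.sum_congr rfl h1, Finset.sum_congr rfl h2, Finset.sum_const,
      Finset.card_powersetCard, Finset.card_univ, Fintype.card_fin, smul_eq_mul] at h
    exact h
  rw [hset, Set.ncard_coe_finset, Finset.card_filter]
  push_cast
  have hle : ∀ U, (A U).card ≤ k := fun U => by
    simpa using Finset.card_le_univ (A U)
  rw [Finset.sum_congr rfl (fun U _ => indicator_identity k x (A U).card (hle U)),
    Finset.sum_comm, Finset.mul_sum]
  refine Finset.sum_congr rfl fun j _ => ?_
  rw [← Finset.mul_sum]
  have h1 : (∑ U ∈ R, ((A U).card.choose (x + j) : ℤ))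
      = (k.choose (x + j) : ℤ) * (gaussBinomZ q (k - (x + j)) ((r : ℤ) - ((x + j : ℕ) : ℤ)) : ℤ) := by
    exact_mod_cast hcount (x + j)
  rw [h1, Nat.sub_sub, sub_sub, Nat.cast_add]
  have := Nat.choose_mul (n := k) (k := x + j) (s := x) (by omega)
  rw [Nat.add_sub_cancel_left] at this
  have h' : (k.choose (x + j) : ℤ) * ((x + j).choose x : ℤ)
    = (k.choose x : ℤ) * ((k - x).choose j : ℤ) := by exact_mod_cast this
  linear_combination (-1 : ℤ) ^ j * (gaussBinomZ q (k - (x + j)) ((r : ℤ) - (x + j)) : ℤ) * h'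

/-- Theorem 1: the number of `r`-dimensional subspaces of `F_q^k` containing exactly
`x` standard unit vectors is `C(k,x) ∑_{j=0}^{k-x} (-1)^j C(k-x,j) [k-x-j, r-x-j]_q`;
equivalently the corresponding probability statement for a uniformly random
`r`-dimensional subspace. -/
theorem card_subspaces_exactly_x_unit_vectors {q k x r : ℕ} (F : Type*) [Field F] [Fintype F]
    (hF : Fintype.card F = q) (hxr : x ≤ r) (hrk : r ≤ k) :
    (({U : Submodule F (Fin k → F) |
        Module.finrank F U = r ∧ {i | Pi.single i (1 : F) ∈ U}.ncard = x}.ncard : ℤ)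
      = (k.choose x : ℤ) *
          ∑ j ∈ Finset.range (k - x + 1),
            (-1 : ℤ) ^ j * ((k - x).choose j : ℤ) *
              (gaussBinomZ q (k - x - j) ((r : ℤ) - x - j) : ℤ))
    ∧ (({U : Submodule F (Fin k → F) |
          Module.finrank F U = r ∧ {i | Pi.single i (1 : F) ∈ U}.ncard = x}.ncard : ℚ)
        / ({U : Submodule F (Fin k → F) | Module.finrank F U = r}.ncard : ℚ)
      = ((k.choose x : ℚ) / (gaussBinom q k r : ℚ)) *
          ∑ j ∈ Finset.range (k - x + 1),
            (-1 : ℚ) ^ j * ((k - x).choose j : ℚ) *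
              (gaussBinomZ q (k - x - j) ((r : ℤ) - x - j) : ℚ)) := by
  have h := main_count (q := q) (k := k) (x := x) (r := r) F hF hrk
  refine ⟨h, ?_⟩
  have hd : {U : Submodule F (Fin k → F) | Module.finrank F U = r}.ncard = gaussBinom q k r := by
    have := card_subspaces_finrank F (Fin k → F) r (by simpa using hrk)
    rw [Module.finrank_fin_fun, hF] at this
    rw [← this]
    rfl
  have hQ := congrArg (Int.cast : ℤ → ℚ) h
  push_cast at hQ
  rw [hd, hQ]
  ring
end

section
/- If U is a uniformly random r-dimensional subspace of F_q^k, the probability that U contains at least x of the k standard unit vectors (x \le r) equals (1 / [k choose r]_q) \sum_{i=x}^{r} \binom{k}{i} \sum_{j=0}^{k-i} (-1)^j \binom{k-i}{j} [k-i-j choose r-i-j]_q. -/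
/-- Falling product. -/
def fallP (q : ℤ) (n d : ℕ) : ℤ := ∏ i ∈ Finset.range d, (q ^ n - q ^ i)

theorem fallP_succ_succ (q : ℤ) (n d : ℕ) :
    fallP q (n + 1) (d + 1) = (q ^ (n + 1) - 1) * q ^ d * fallP q n d := by
  unfold fallP
  rw [Finset.prod_range_succ']
  have : ∀ i ∈ Finset.range d, q ^ (n + 1) - q ^ (i + 1) = q * (q ^ n - q ^ i) := by
    intro i _; ring
  rw [Finset.prod_congr rfl this, Finset.prod_mul_distrib]
  simp
  ring

theorem gaussBinom_mul_fallP (q : ℕ) (n d : ℕ) :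
    (gaussBinom q n d : ℤ) * fallP q d d = fallP q n d := by
  induction n generalizing d with
  | zero =>
    cases d with
    | zero => simp [gaussBinom, fallP]
    | succ d => simp [gaussBinom, fallP, Finset.prod_range_succ']
  | succ n ih =>
    cases d with
    | zero => simp [gaussBinom, fallP]
    | succ d =>
      have h1 := ih d
      have h2 := ih (d + 1)
      have h3 : fallP (q : ℤ) n (d + 1) = fallP q n d * ((q : ℤ) ^ n - (q : ℤ) ^ d) := by
        simp [fallP, Finset.prod_range_succ]
      have h4 := fallP_succ_succ (q : ℤ) n d
      have h5 := fallP_succ_succ (q : ℤ) d d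
      rw [gaussBinom]
      push_cast
      rw [add_mul, mul_assoc, h2, h3, h4, h5]
      have : (gaussBinom q n d : ℤ) * (((q : ℤ) ^ (d + 1) - 1) * (q : ℤ) ^ d * fallP q d d)
        = (((q : ℤ) ^ (d + 1) - 1) * (q : ℤ) ^ d) * fallP q n d := by
        rw [← h1]; ring
      rw [this]
      ring

section
variable {F V : Type*} [Field F] [Fintype F] [AddCommGroup V] [Module F V] [Finite V]

theorem card_li_eq (d : ℕ) (hd : d ≤ Module.finrank F V) :
    (Nat.card { s : Fin d → V // LinearIndependent F s } : ℤ)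
      = fallP (Fintype.card F : ℤ) (Module.finrank F V) d := by
  rw [card_linearIndependent hd, fallP, Finset.prod_range]
  push_cast
  refine Finset.prod_congr rfl fun i _ => ?_
  rw [Nat.cast_sub]
  · push_cast; rfl
  · exact Nat.pow_le_pow_right Fintype.card_pos (by omega)

/-- Independent tuples, sorted by their span. -/
noncomputable def liEquiv (d : ℕ) : { s : Fin d → V // LinearIndependent F s } ≃
    Σ U : {U : Submodule F V // Module.finrank F U = d},
      { s : Fin d → U.1 // LinearIndependent F s } where
  toFun s := ⟨⟨Submodule.span F (Set.range s.1), by simpa using finrank_span_eq_card s.2⟩,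
    ⟨fun i => ⟨s.1 i, Submodule.subset_span ⟨i, rfl⟩⟩, linearIndependent_span s.2⟩⟩
  invFun t := ⟨fun i => (t.2.1 i : V), t.2.2.map' (Submodule.subtype _) (Submodule.ker_subtype _)⟩
  left_inv s := rfl
  right_inv := by
    rintro ⟨⟨U, hU⟩, ⟨s, hs⟩⟩
    have hli : LinearIndependent F (fun i => (s i : V)) :=
      hs.map' (Submodule.subtype _) (Submodule.ker_subtype _)
    have key : Submodule.span F (Set.range fun i => (s i : V)) = U := by
      apply Submodule.eq_of_le_of_finrank_eq
      · rw [Submodule.span_le]; rintro _ ⟨i, rfl⟩; exact (s i).2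
      · rw [finrank_span_eq_card hli, hU]; simp
    have gen : ∀ (W : Submodule F V) (hW : W = U) (h1 : Module.finrank F W = d)
        (h2 : ∀ i, (s i : V) ∈ W) (h3 : LinearIndependent F (fun i => (⟨s i, h2 i⟩ : W))),
        (⟨⟨W, h1⟩, ⟨fun i => ⟨s i, h2 i⟩, h3⟩⟩ :
          Σ U : {U : Submodule F V // Module.finrank F U = d},
            { s : Fin d → U.1 // LinearIndependent F s }) = ⟨⟨U, hU⟩, ⟨s, hs⟩⟩ := by
      rintro W rfl h1 h2 h3
      rfl
    exact gen _ key _ _ _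

theorem card_subspaces (d : ℕ) (hd : d ≤ Module.finrank F V) :
    {U : Submodule F V | Module.finrank F U = d}.ncard
      = gaussBinom (Fintype.card F) (Module.finrank F V) d := by
  classical
  have := Fintype.ofFinite {U : Submodule F V // Module.finrank F U = d}
  have h := Nat.card_congr (liEquiv (F := F) (V := V) d)
  rw [Nat.card_sigma] at h
  have h' := congrArg (Nat.cast : ℕ → ℤ) h
  rw [card_li_eq d hd] at h'
  push_cast at h'
  have h2 : ∀ U : {U : Submodule F V // Module.finrank F U = d},
      (Nat.card { s : Fin d → U.1 // LinearIndependent F s } : ℤ)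
        = fallP (Fintype.card F : ℤ) d d := by
    intro U
    rw [card_li_eq d U.2.ge, U.2]
  rw [Finset.sum_congr rfl (fun U _ => h2 U), Finset.sum_const, ← gaussBinom_mul_fallP,
    nsmul_eq_mul] at h'
  have hne : fallP (Fintype.card F : ℤ) d d ≠ 0 := by
    rw [fallP, Finset.prod_ne_zero_iff]
    intro i hi
    have : (Fintype.card F : ℤ) ^ i < (Fintype.card F : ℤ) ^ d :=
      pow_lt_pow_right₀ (by exact_mod_cast Fintype.one_lt_card) (Finset.mem_range.1 hi)
    omega
  have h3 := mul_right_cancel₀ hne h'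
  rw [← Nat.card_coe_set_eq]
  have : Nat.card {U : Submodule F V | Module.finrank F U = d} =
    Nat.card {U : Submodule F V // Module.finrank F U = d} := rfl
  rw [this, Nat.card_eq_fintype_card]
  rw [Finset.card_univ] at h3
  exact_mod_cast h3.symm

theorem finrank_map_mkQ_add (p U : Submodule F V) (h : p ≤ U) :
    Module.finrank F (U.map p.mkQ) + Module.finrank F p = Module.finrank F U := by
  have h1 := (Submodule.quotientQuotientEquivQuotient p U h).finrank_eq
  have h2 := Submodule.finrank_quotient_add_finrank (U.map p.mkQ)
  have h3 := Submodule.finrank_quotient_add_finrank U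
  have h4 := Submodule.finrank_quotient_add_finrank p
  omega

theorem card_subspaces_ge_s7 (p : Submodule F V) (r : ℕ) (hr : r ≤ Module.finrank F V) :
    {U : Submodule F V | Module.finrank F U = r ∧ p ≤ U}.ncard
      = gaussBinomZ (Fintype.card F) (Module.finrank F V - Module.finrank F p)
        ((r : ℤ) - Module.finrank F p) := by
  unfold gaussBinomZ
  split_ifs with h
  · have h4 := Submodule.finrank_quotient_add_finrank p
    have e1 : Module.finrank F V - Module.finrank F p = Module.finrank F (V ⧸ p) := by omega
    have e2 : ((r : ℤ) - Module.finrank F p).toNat = r - Module.finrank F p := by omega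
    have : Finite (V ⧸ p) := Finite.of_surjective _ p.mkQ_surjective
    rw [e1, e2, ← card_subspaces (V := V ⧸ p) _ (by omega)]
    refine Set.ncard_congr (fun U _ => U.map p.mkQ) ?_ ?_ ?_
    · rintro U ⟨h1, h2⟩
      have := finrank_map_mkQ_add p U h2
      simp only [Set.mem_ofPred_eq]
      omega
    · rintro U U' ⟨h1, h2⟩ ⟨h1', h2'⟩ he
      have := congrArg (Submodule.comap p.mkQ) he
      simpa [Submodule.comap_map_mkQ, h2, h2'] using this
    · rintro W hW
      have hle : p ≤ W.comap p.mkQ := Submodule.le_comap_mkQ p W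
      have hm : (W.comap p.mkQ).map p.mkQ = W :=
        Submodule.map_comap_eq_of_surjective p.mkQ_surjective W
      refine ⟨W.comap p.mkQ, ⟨?_, hle⟩, hm⟩
      have := finrank_map_mkQ_add p _ hle
      rw [hm] at this
      simp only [Set.mem_ofPred_eq] at hW
      omega
  · rw [Set.ncard_eq_zero]
    ext U
    simp only [Set.mem_ofPred_eq, Set.mem_empty_iff_false, iff_false, not_and]
    intro h1 h2
    have := Submodule.finrank_mono h2
    omega

theorem finrank_span_units {k : ℕ} (S : Finset (Fin k)) :
    Module.finrank F (Submodule.span F (Set.image (fun i : Fin k => (Pi.single i (1 : F) : Fin k → F)) S))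
      = S.card := by
  have hli : LinearIndependent F (fun i : Fin k => (Pi.single i (1 : F) : Fin k → F)) := by
    have := (Pi.basisFun F (Fin k)).linearIndependent
    convert this using 1
    ext i j
    simp
  have h2 := hli.comp (fun i : S => (i : Fin k)) Subtype.val_injective
  have h3 := finrank_span_eq_card h2
  rw [Set.range_comp] at h3
  have h4 : (Set.range fun i : S => (i : Fin k)) = (S : Set (Fin k)) := Subtype.range_coe
  rw [h4] at h3
  simpa using h3

end

open Classical in
/-- The set of unit vectors in a subspace. -/
noncomputable def unitsIn {F : Type*} [Field F] {k : ℕ} (U : Submodule F (Fin k → F)) :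
    Finset (Fin k) := Finset.univ.filter fun i => (Pi.single i (1 : F) : Fin k → F) ∈ U

theorem units_iff {F : Type*} [Field F] {k : ℕ} (U : Submodule F (Fin k → F))
    (S : Finset (Fin k)) : S ⊆ unitsIn U ↔
    Submodule.span F (Set.image (fun i : Fin k => (Pi.single i (1 : F) : Fin k → F)) S) ≤ U := by
  rw [Submodule.span_le, Set.image_subset_iff]
  constructor
  · intro h i hi
    simpa [unitsIn] using h hi
  · intro h i hi
    simpa [unitsIn] using h hi

theorem units_card_le {F : Type*} [Field F] [Fintype F] {k : ℕ} (U : Submodule F (Fin k → F)) :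
    (unitsIn U).card ≤ Module.finrank F U := by
  rw [← finrank_span_units (F := F) (unitsIn U)]
  exact Submodule.finrank_mono ((units_iff U _).1 subset_rfl)

theorem indicator_eq {k : ℕ} (S u : Finset (Fin k)) :
    (if u = S then (1 : ℚ) else 0) =
      ∑ T ∈ Sᶜ.powerset, (-1 : ℚ) ^ T.card * (if S ∪ T ⊆ u then 1 else 0) := by
  by_cases hS : S ⊆ u
  · have h1 : ∑ T ∈ Sᶜ.powerset, (-1 : ℚ) ^ T.card * (if S ∪ T ⊆ u then 1 else 0)
        = ∑ T ∈ (u \ S).powerset, (-1 : ℚ) ^ T.card := by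
      simp only [mul_ite, mul_one, mul_zero]
      rw [← Finset.sum_filter]
      refine Finset.sum_congr ?_ fun _ _ => rfl
      ext T
      simp only [Finset.mem_filter, Finset.mem_powerset, Finset.union_subset_iff, hS, true_and,
        Finset.subset_sdiff, ← le_compl_iff_disjoint_right]
      exact and_comm
    rw [h1]
    have h2 := congrArg (Int.cast : ℤ → ℚ) (Finset.sum_powerset_neg_one_pow_card (x := u \ S))
    push_cast at h2
    rw [h2]
    have : u = S ↔ u \ S = ∅ := by
      rw [Finset.sdiff_eq_empty_iff_subset]
      exact ⟨fun h => h.subset, fun h => h.antisymm hS⟩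
    simp only [this]
  · rw [if_neg (fun h => hS h.symm.subset), Finset.sum_eq_zero]
    intro T _
    rw [if_neg (fun h => hS (Finset.union_subset_left h)), mul_zero]

theorem card_exact {k r : ℕ} (F : Type*) [Field F] [Fintype F] (hrk : r ≤ k)
    (S : Finset (Fin k)) :
    ({U : Submodule F (Fin k → F) | Module.finrank F U = r ∧ unitsIn U = S}.ncard : ℚ)
      = ∑ j ∈ Finset.range (k - S.card + 1),
            (-1 : ℚ) ^ j * ((k - S.card).choose j : ℚ) *
              (gaussBinomZ (Fintype.card F) (k - S.card - j) ((r : ℤ) - S.card - j) : ℚ) := by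
  have := Fintype.ofFinite (Submodule F (Fin k → F))
  have cnt : ∀ (P : Submodule F (Fin k → F) → Prop) [DecidablePred P],
      ({U : Submodule F (Fin k → F) | Module.finrank F U = r ∧ P U}.ncard : ℚ)
      = ∑ U ∈ Finset.univ.filter (fun U : Submodule F (Fin k → F) => Module.finrank F U = r),
          if P U then (1 : ℚ) else 0 := by
    intro P _
    rw [Finset.sum_boole, Finset.filter_filter, ← Set.ncard_coe_finset]
    simp
  have hT : ∀ T ∈ Sᶜ.powerset, ∑ U ∈ Finset.univ.filter
      (fun U : Submodule F (Fin k → F) => Module.finrank F U = r),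
        (if S ∪ T ⊆ unitsIn U then (1 : ℚ) else 0)
      = (gaussBinomZ (Fintype.card F) (k - S.card - T.card) ((r : ℤ) - S.card - T.card) : ℚ) := by
    intro T hT
    rw [← cnt (fun U => S ∪ T ⊆ unitsIn U)]
    simp only [units_iff]
    rw [card_subspaces_ge_s7 _ r (by simpa using hrk), finrank_span_units,
      Finset.card_union_of_disjoint]
    · simp only [Module.finrank_fin_fun, Nat.cast_add, Nat.sub_sub, sub_sub]
    · rw [Finset.mem_powerset] at hT
      exact (Finset.disjoint_of_subset_right hT disjoint_compl_right)
  rw [cnt (fun U => unitsIn U = S)]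
  simp only [indicator_eq]
  rw [Finset.sum_comm]
  simp only [← Finset.mul_sum]
  rw [Finset.sum_congr rfl (fun T h => by rw [hT T h])]
  rw [Finset.sum_powerset_apply_card (fun j => (-1 : ℚ) ^ j *
    (gaussBinomZ (Fintype.card F) (k - S.card - j) ((r : ℤ) - S.card - j) : ℚ))]
  rw [Finset.card_compl, Fintype.card_fin]
  refine Finset.sum_congr rfl fun j _ => ?_
  rw [nsmul_eq_mul]
  ring

/-- Corollary 1: for a uniformly random `r`-dimensional subspace `U` of `F_q^k`,
the probability that `U` contains at least `x` of the standard unit vectors equals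
`(1/[k,r]_q) ∑_{i=x}^{r} C(k,i) ∑_{j=0}^{k-i} (-1)^j C(k-i,j) [k-i-j, r-i-j]_q`. -/
theorem prob_at_least_x_unit_vectors {q k x r : ℕ} (F : Type*) [Field F] [Fintype F]
    (hF : Fintype.card F = q) (hxr : x ≤ r) (hrk : r ≤ k) :
    ({U : Submodule F (Fin k → F) |
        Module.finrank F U = r ∧ x ≤ {i | Pi.single i (1 : F) ∈ U}.ncard}.ncard : ℚ)
      / ({U : Submodule F (Fin k → F) | Module.finrank F U = r}.ncard : ℚ)
    = (1 / (gaussBinom q k r : ℚ)) *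
        ∑ i ∈ Finset.Icc x r, (k.choose i : ℚ) *
          ∑ j ∈ Finset.range (k - i + 1),
            (-1 : ℚ) ^ j * ((k - i).choose j : ℚ) *
              (gaussBinomZ q (k - i - j) ((r : ℤ) - i - j) : ℚ) := by
  classical
  subst hF
  have := Fintype.ofFinite (Submodule F (Fin k → F))
  have hden := card_subspaces (F := F) (V := Fin k → F) r (by simpa using hrk)
  rw [Module.finrank_fin_fun] at hden
  rw [hden, div_eq_mul_inv, mul_comm, one_div]
  congr 1
  have hu : ∀ U : Submodule F (Fin k → F),
      {i | (Pi.single i (1 : F) : Fin k → F) ∈ U}.ncard = (unitsIn U).card := by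
    intro U
    rw [← Set.ncard_coe_finset]
    simp [unitsIn]
  simp only [hu]
  have hi : ∀ i ∈ Finset.Icc x r, (k.choose i : ℚ) *
          ∑ j ∈ Finset.range (k - i + 1),
            (-1 : ℚ) ^ j * ((k - i).choose j : ℚ) *
              (gaussBinomZ (Fintype.card F) (k - i - j) ((r : ℤ) - i - j) : ℚ)
      = ((Finset.univ.filter (fun U : Submodule F (Fin k → F) =>
          Module.finrank F U = r ∧ (unitsIn U).card = i)).card : ℚ) := by
    intro i _
    rw [Finset.card_eq_sum_card_fiberwise (f := fun U => unitsIn U)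
      (t := Finset.powersetCard i Finset.univ)]
    · push_cast
      rw [Finset.sum_congr (s₁ := Finset.powersetCard i Finset.univ) rfl (g := fun _ => ∑ j ∈ Finset.range (k - i + 1),
            (-1 : ℚ) ^ j * ((k - i).choose j : ℚ) *
              (gaussBinomZ (Fintype.card F) (k - i - j) ((r : ℤ) - i - j) : ℚ))]
      · simp
      · intro S hS
        have hS' := (Finset.mem_powersetCard.1 hS).2
        subst hS'
        rw [← card_exact F hrk S, ← Set.ncard_coe_finset]
        congr 2
        ext U
        simp only [Finset.coe_filter, Finset.mem_filter, Finset.mem_univ, true_and,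
          Set.mem_ofPred_eq]
        constructor
        · rintro ⟨⟨a, b⟩, c⟩; exact ⟨a, c⟩
        · rintro ⟨a, c⟩; exact ⟨⟨a, by rw [c]⟩, c⟩
    · intro U hU
      simp at hU
      simp [hU.2]
  rw [Finset.sum_congr rfl hi, ← Nat.cast_sum]
  congr 1
  have e : {U : Submodule F (Fin k → F) | Module.finrank F U = r ∧ x ≤ (unitsIn U).card}
      = ((Finset.univ.filter (fun U : Submodule F (Fin k → F) =>
          Module.finrank F U = r ∧ x ≤ (unitsIn U).card) : Finset _) : Set _) := by
    ext U; simp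
  rw [e, Set.ncard_coe_finset, Finset.card_eq_sum_card_fiberwise (f := fun U => (unitsIn U).card)
      (t := Finset.Icc x r)]
  · refine Finset.sum_congr rfl fun i hi => ?_
    congr 1
    ext U
    have := (Finset.mem_Icc.1 hi).1
    simp only [Finset.mem_filter, Finset.mem_univ, true_and]
    constructor
    · rintro ⟨⟨a, b⟩, c⟩; exact ⟨a, c⟩
    · rintro ⟨a, c⟩; exact ⟨⟨a, by omega⟩, c⟩
  · intro U hU
    simp only [Finset.coe_filter, Finset.mem_univ, true_and, Set.mem_ofPred_eq] at hU
    have := units_card_le U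
    simp only [Finset.coe_Icc, Set.mem_Icc]
    omega
end
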